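/- arXiv:2506.13160 — 2 statements merged into one kernel-verified Lean document; each statement's English description precedes it below -/
import Mathlib

section
/- Let d ∈ ℕ, σ > 0, x, r : Fin d → ℝ, t ∈ ℝ, and let ν := Measure.pi (fun i => ProbabilityTheory.gaussianReal 0 (σ²)). Then for every measurable set A ⊆ (Fin d → ℝ): if (ν {ε | x + r + ε ∈ A}).toReal ≥ Φ(t), then (ν {ε | x + ε ∈ A}).toReal ≥ Φ(t − ‖r‖₂ / σ), where ‖r‖₂ = √(∑ i, (r i)²). -/
open MeasureTheory
open scoped ENNReal NNReal

/-- The standard normal CDF. -/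
noncomputable def stdNormalCDF (t : ℝ) : ℝ :=
  ((ProbabilityTheory.gaussianReal 0 1) (Set.Iic t)).toReal

open ProbabilityTheory

/-- The Neyman–Pearson lemma for a deterministic likelihood-ratio test: if the density `f` is at
least `k` on `H` and at most `k` off `H`, then no set that is at least as likely as `H` under
`μ.withDensity f` is less likely than `H` under `μ`. -/
theorem measure_le_of_withDensity_le {α : Type*} [MeasurableSpace α] {μ : Measure α}
    [IsFiniteMeasure μ] {f : α → ℝ≥0∞} [IsFiniteMeasure (μ.withDensity f)] {k : ℝ≥0∞}
    (hk₀ : k ≠ 0) (hk : k ≠ ∞) {A H : Set α} (hA : MeasurableSet A) (hH : MeasurableSet H)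
    (hle : ∀ a ∈ H, k ≤ f a) (hge : ∀ a ∉ H, f a ≤ k)
    (h : μ.withDensity f H ≤ μ.withDensity f A) : μ H ≤ μ A := by
  have hdiff : μ.withDensity f (H \ A) ≤ μ.withDensity f (A \ H) := by
    rw [← measure_inter_add_sdiff H hA, ← measure_inter_add_sdiff A hH, Set.inter_comm A H] at h
    exact (ENNReal.add_le_add_iff_left (measure_ne_top _ _)).1 h
  have hlower : k * μ (H \ A) ≤ μ.withDensity f (H \ A) := by
    rw [withDensity_apply _ (hH.diff hA), ← setLIntegral_const]
    exact setLIntegral_mono' (hH.diff hA) fun a ha ↦ hle a ha.1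
  have hupper : μ.withDensity f (A \ H) ≤ k * μ (A \ H) := by
    rw [withDensity_apply _ (hA.diff hH), ← setLIntegral_const]
    exact setLIntegral_mono' (hA.diff hH) fun a ha ↦ hge a ha.2
  have hμ : μ (H \ A) ≤ μ (A \ H) :=
    (ENNReal.mul_le_mul_iff_right hk₀ hk).1 (hlower.trans (hdiff.trans hupper))
  rw [← measure_inter_add_sdiff H hA, ← measure_inter_add_sdiff A hH, Set.inter_comm A H]
  gcongr

theorem gaussianReal_eq_withDensity_gaussianReal_zero (m : ℝ) {v : ℝ≥0} (hv : v ≠ 0) :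
    gaussianReal m v = (gaussianReal 0 v).withDensity
      fun z ↦ ENNReal.ofReal (Real.exp ((m * z - m ^ 2 / 2) / v)) := by
  rw [gaussianReal_of_var_ne_zero _ hv, gaussianReal_of_var_ne_zero _ hv,
    ← withDensity_mul _ (measurable_gaussianPDF 0 v) (by fun_prop)]
  congr 1
  ext z
  have hv' : (v : ℝ) ≠ 0 := by exact_mod_cast hv
  rw [Pi.mul_apply, gaussianPDF, gaussianPDF, ← ENNReal.ofReal_mul (gaussianPDFReal_nonneg _ _ _),
    gaussianPDFReal, gaussianPDFReal, mul_assoc _ (Real.exp _) (Real.exp _), ← Real.exp_add]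
  congr 3
  field_simp
  ring

/-- The finite-dimensional Cameron–Martin formula for an isotropic Gaussian measure. -/
theorem pi_gaussianReal_eq_withDensity {ι : Type*} [Fintype ι] (m : ι → ℝ) {v : ℝ≥0}
    (hv : v ≠ 0) :
    (Measure.pi fun i ↦ gaussianReal (m i) v) =
      (Measure.pi fun _ : ι ↦ gaussianReal 0 v).withDensity
        fun z ↦ ENNReal.ofReal (Real.exp ((∑ i, m i * z i - ∑ i, m i ^ 2 / 2) / v)) := by
  refine Measure.pi_eq fun s hs ↦ ?_
  let g (i : ι) : ℝ → ℝ≥0∞ :=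
    (s i).indicator fun z ↦ ENNReal.ofReal (Real.exp ((m i * z - m i ^ 2 / 2) / v))
  have hg (i : ι) : Measurable (g i) := Measurable.indicator (by fun_prop) (hs i)
  have hprod : ∀ z : ι → ℝ, (Set.univ.pi s).indicator
      (fun z ↦ ENNReal.ofReal (Real.exp ((∑ i, m i * z i - ∑ i, m i ^ 2 / 2) / v))) z =
        ∏ i, g i (z i) := by
    intro z
    by_cases hz : z ∈ Set.univ.pi s
    · have hz' (i : ι) : z i ∈ s i := hz i trivial
      simp only [g, Set.indicator_of_mem hz, Set.indicator_of_mem (hz' _)]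
      rw [← ENNReal.ofReal_prod_of_nonneg fun i _ ↦ (Real.exp_pos _).le, ← Real.exp_sum,
        ← Finset.sum_sub_distrib, Finset.sum_div]
    · rw [Set.indicator_of_notMem hz]
      obtain ⟨i, hi⟩ : ∃ i, z i ∉ s i := by simpa using hz
      exact (Finset.prod_eq_zero (Finset.mem_univ i) (Set.indicator_of_notMem hi _)).symm
  rw [withDensity_apply _ (.univ_pi hs), ← lintegral_indicator (.univ_pi hs)]
  simp_rw [hprod]
  rw [lintegral_prod_eq_prod_lintegral_of_indepFun Finset.univ
    (fun i (z : ι → ℝ) ↦ g i (z i))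
    (iIndepFun_pi fun i ↦ (hg i).aemeasurable) fun i ↦ (hg i).comp (measurable_pi_apply i)]
  refine Finset.prod_congr rfl fun i _ ↦ ?_
  rw [(measurePreserving_eval (fun _ : ι ↦ gaussianReal 0 v) i).lintegral_comp (hg i),
    lintegral_indicator (hs i), ← withDensity_apply _ (hs i),
    ← gaussianReal_eq_withDensity_gaussianReal_zero _ hv]

theorem map_sum_mul_pi_gaussianReal {ι : Type*} [Fintype ι] (r m : ι → ℝ) (v : ℝ≥0) :
    (Measure.pi fun i ↦ gaussianReal (m i) v).map (fun z ↦ ∑ i, r i * z i) =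
      gaussianReal (∑ i, r i * m i) (∑ i, r i ^ 2 * v).toNNReal := by
  have hscale := Measure.pi_map_pi (μ := fun i ↦ gaussianReal (m i) v)
    (f := fun i y ↦ r i * y) fun i ↦ by fun_prop
  have hcomp : (fun z : ι → ℝ ↦ ∑ i, r i * z i) = (fun z ↦ ∑ i, z i) ∘ fun z i ↦ r i * z i := rfl
  simp_rw [gaussianReal_map_const_mul] at hscale
  rw [hcomp, ← Measure.map_map (by fun_prop) (by fun_prop), hscale]
  apply Measure.ext_of_charFun
  rw [charFun_map_sum_pi_eq_prod]
  ext u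
  simp only [Finset.prod_apply, charFun_gaussianReal, ← Complex.exp_sum, Finset.sum_sub_distrib]
  rw [Real.coe_toNNReal _ (by positivity)]
  push_cast
  simp [Finset.mul_sum, Finset.sum_mul, Finset.sum_div]

theorem gaussianReal_sq_Ici (m c : ℝ) {s : ℝ≥0} (hs : 0 < s) :
    gaussianReal m (s ^ 2) (Set.Ici c) = gaussianReal 0 1 (Set.Iic ((m - c) / s)) := by
  have hmap : (gaussianReal 0 1).map (fun y ↦ m + -(s : ℝ) * y) = gaussianReal m (s ^ 2) := by
    change (gaussianReal 0 1).map ((fun y ↦ m + y) ∘ fun y ↦ -(s : ℝ) * y) = _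
    rw [← Measure.map_map (by fun_prop) (by fun_prop), gaussianReal_map_const_mul,
      gaussianReal_map_const_add]
    congr 1
    · ring
    · ext; simp
  rw [← hmap, Measure.map_apply (by fun_prop) measurableSet_Ici]
  congr 1
  ext y
  have hs' : (0 : ℝ) < s := hs
  rw [Set.mem_preimage, Set.mem_Ici, Set.mem_Iic, le_div_iff₀ hs']
  constructor <;> intro <;> linarith

theorem pi_gaussianReal_halfSpace {ι : Type*} [Fintype ι] {r : ι → ℝ} (hr : 0 < ∑ i, r i ^ 2)
    (m : ι → ℝ) {σ : ℝ≥0} (hσ : 0 < σ) (c : ℝ) :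
    (Measure.pi fun i ↦ gaussianReal (m i) (σ ^ 2)) {z | c ≤ ∑ i, r i * z i} =
      gaussianReal 0 1 (Set.Iic ((∑ i, r i * m i - c) / (√(∑ i, r i ^ 2) * σ))) := by
  have hs : 0 < (√(∑ i, r i ^ 2)).toNNReal * σ := by positivity
  have hmap := map_sum_mul_pi_gaussianReal r m (σ ^ 2)
  have hvar : (∑ i, r i ^ 2 * ((σ ^ 2 : ℝ≥0) : ℝ)).toNNReal =
      ((√(∑ i, r i ^ 2)).toNNReal * σ) ^ 2 := by
    ext
    rw [← Finset.sum_mul, Real.coe_toNNReal _ (by positivity)]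
    push_cast
    rw [mul_pow, Real.coe_toNNReal _ (by positivity), Real.sq_sqrt hr.le]
  rw [hvar] at hmap
  change (Measure.pi fun i ↦ gaussianReal (m i) (σ ^ 2)) ((fun z : ι → ℝ ↦ ∑ i, r i * z i) ⁻¹' Set.Ici c) = _
  rw [← Measure.map_apply (by fun_prop) measurableSet_Ici, hmap, gaussianReal_sq_Ici _ _ hs]
  push_cast
  rw [Real.coe_toNNReal _ (by positivity)]

/-- Gaussian robustness bound (Neyman–Pearson): if the probability under isotropic
Gaussian noise that the shifted input `x + r + ε` lands in `A` is at least `Φ(t)`, then the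
probability that the unshifted input `x + ε` lands in `A` is at least `Φ(t − ‖r‖₂/σ)`. -/
theorem gaussian_robustness_bound (d : ℕ) (σ : ℝ≥0) (hσ : 0 < σ)
    (x r : Fin d → ℝ) (t : ℝ) (A : Set (Fin d → ℝ)) (hA : MeasurableSet A)
    (h : (((Measure.pi fun i => ProbabilityTheory.gaussianReal 0 (σ ^ 2)))
        {ε : Fin d → ℝ | x + r + ε ∈ A}).toReal ≥ stdNormalCDF t) :
    (((Measure.pi fun i => ProbabilityTheory.gaussianReal 0 (σ ^ 2)))
        {ε : Fin d → ℝ | x + ε ∈ A}).toReal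
      ≥ stdNormalCDF (t - Real.sqrt (∑ i, (r i) ^ 2) / (σ : ℝ)) := by
  rcases (Finset.sum_nonneg fun i _ ↦ sq_nonneg (r i)).eq_or_lt with h₀ | hpos
  · have hr : r = 0 := by
      ext i
      simpa using (Finset.sum_eq_zero_iff_of_nonneg fun i _ ↦ sq_nonneg (r i)).1 h₀.symm i
        (Finset.mem_univ i)
    simpa [hr] using h
  have hv : σ ^ 2 ≠ 0 := by positivity
  have hσ' : (0 : ℝ) < σ := hσ
  set n := √(∑ i, r i ^ 2) with hn
  have hn₀ : 0 < n := Real.sqrt_pos.2 hpos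
  have hnn : ∑ i, r i * r i = n ^ 2 := by
    simp_rw [hn, Real.sq_sqrt hpos.le, sq]
  have hcm := pi_gaussianReal_eq_withDensity r hv
  set f : (Fin d → ℝ) → ℝ≥0∞ := fun z ↦ ENNReal.ofReal
    (Real.exp ((∑ i, r i * z i - ∑ i, r i ^ 2 / 2) / ((σ ^ 2 : ℝ≥0) : ℝ))) with hf
  set c := n ^ 2 - n * σ * t with hc
  set k := ENNReal.ofReal (Real.exp ((c - ∑ i, r i ^ 2 / 2) / ((σ ^ 2 : ℝ≥0) : ℝ))) with hk
  have hB : MeasurableSet {ε : Fin d → ℝ | x + ε ∈ A} := (measurable_const_add x) hA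
  have hH : MeasurableSet {z : Fin d → ℝ | c ≤ ∑ i, r i * z i} :=
    measurableSet_le (by fun_prop) (by fun_prop)
  have hfin : IsFiniteMeasure
      ((Measure.pi fun _ : Fin d ↦ gaussianReal 0 (σ ^ 2)).withDensity f) := by
    rw [← hcm]; infer_instance
  have hshift : (Measure.pi fun _ : Fin d ↦ gaussianReal 0 (σ ^ 2)) {ε | x + r + ε ∈ A} =
      (Measure.pi fun i ↦ gaussianReal (r i) (σ ^ 2)) {ε | x + ε ∈ A} := by
    have hmap := Measure.pi_map_pi (μ := fun _ : Fin d ↦ gaussianReal 0 (σ ^ 2))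
      (f := fun i y ↦ r i + y) fun i ↦ by fun_prop
    simp_rw [gaussianReal_map_const_add, zero_add] at hmap
    rw [← hmap, Measure.map_apply (by fun_prop) hB]
    congr 1
    ext ε
    simp only [Set.mem_ofPred_eq, Set.mem_preimage, add_assoc]
    rfl
  have key : (Measure.pi fun _ : Fin d ↦ gaussianReal 0 (σ ^ 2)) {z | c ≤ ∑ i, r i * z i} ≤
      (Measure.pi fun _ : Fin d ↦ gaussianReal 0 (σ ^ 2)) {ε | x + ε ∈ A} := by
    refine measure_le_of_withDensity_le (f := f) (k := k) (by simp [hk, Real.exp_pos])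
      ENNReal.ofReal_ne_top hB hH (fun z hz ↦ ?_) (fun z hz ↦ ?_) ?_
    · have hz : c ≤ ∑ i, r i * z i := hz
      simp only [hf, hk]
      gcongr
    · have hz : ∑ i, r i * z i ≤ c := (not_le.1 hz).le
      simp only [hf, hk]
      gcongr
    · rw [← hcm, ← hshift, pi_gaussianReal_halfSpace hpos r hσ, ← hn, hnn]
      have : (n ^ 2 - c) / (n * σ) = t := by rw [hc]; field_simp; ring
      rw [this]
      exact (ENNReal.toReal_le_toReal (measure_ne_top _ _) (measure_ne_top _ _)).1 h
  rw [pi_gaussianReal_halfSpace hpos _ hσ, ← hn] at key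
  have hthr : (∑ i, r i * 0 - c) / (n * σ) = t - n / σ := by
    simp only [mul_zero, Finset.sum_const_zero, hc]; field_simp; ring
  rw [hthr] at key
  exact ENNReal.toReal_mono (measure_ne_top _ _) key
end

section
/- Let d, K ∈ ℕ with K ≥ 1, σ > 0, R ≥ 0, and let ν := Measure.pi (fun i => ProbabilityTheory.gaussianReal 0 (σ²)) on (Fin d → ℝ). Let f : (Fin d → ℝ) → ℕ be measurable, ŷ ∈ ℕ, x, r : Fin K → (Fin d → ℝ) with ‖r k‖₂ ≤ R for all k, and let W ∈ [0,1], τ ∈ ℝ. If (ν {ε | f (x k + r k + ε) = ŷ}).toReal ≥ W for every k, and W > Φ(R / σ) + τ, then (ν {ε | f (x k + ε) = ŷ}).toReal > τ for every k. -/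
open MeasureTheory
open scoped ENNReal NNReal

open ProbabilityTheory in
/-- A product of probability measures with densities has the product density. -/
theorem pi_withDensity_prod {ι : Type*} [Fintype ι] {α : ι → Type*} [∀ i, MeasurableSpace (α i)]
    (μ : ∀ i, Measure (α i)) [∀ i, IsProbabilityMeasure (μ i)] (g : ∀ i, α i → ℝ≥0∞)
    (hg : ∀ i, Measurable (g i)) [∀ i, SigmaFinite ((μ i).withDensity (g i))] :
    Measure.pi (fun i => (μ i).withDensity (g i)) =
      (Measure.pi μ).withDensity fun x => ∏ i, g i (x i) := by
  refine Measure.pi_eq fun s hs => ?_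
  rw [withDensity_apply _ (MeasurableSet.univ_pi hs),
    ← lintegral_indicator (MeasurableSet.univ_pi hs)]
  have hind : (Set.univ.pi s).indicator (fun x : ∀ i, α i => ∏ i, g i (x i)) =
      fun x => ∏ i, (s i).indicator (g i) (x i) := by
    ext x
    by_cases hx : x ∈ Set.univ.pi s
    · rw [Set.indicator_of_mem hx]
      exact Finset.prod_congr rfl fun i _ => (Set.indicator_of_mem (hx i trivial) _).symm
    · rw [Set.indicator_of_notMem hx]
      obtain ⟨i, hi⟩ : ∃ i, x i ∉ s i := by simpa [Set.mem_pi] using hx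
      exact (Finset.prod_eq_zero (Finset.mem_univ i) (Set.indicator_of_notMem hi _)).symm
  have hm : ∀ i, Measurable ((s i).indicator (g i)) := fun i => (hg i).indicator (hs i)
  rw [hind, lintegral_prod_eq_prod_lintegral_of_indepFun _
    (fun i (x : ∀ i, α i) => (s i).indicator (g i) (x i))
    (iIndepFun_pi fun i => (hm i).aemeasurable) fun i => (hm i).comp (measurable_pi_apply i)]
  refine Finset.prod_congr rfl fun i _ => ?_
  rw [(measurePreserving_eval μ i).lintegral_comp (hm i), lintegral_indicator (hs i),
    withDensity_apply _ (hs i)]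

namespace ProbabilityTheory

/-- The density of a translated Gaussian with respect to the centred one. -/
theorem gaussianReal_eq_withDensity_gaussianReal_zero (m : ℝ) {v : ℝ≥0} (hv : v ≠ 0) :
    gaussianReal m v = (gaussianReal 0 v).withDensity
      fun x => ENNReal.ofReal (Real.exp ((m * x - m ^ 2 / 2) / v)) := by
  rw [gaussianReal_of_var_ne_zero _ hv, gaussianReal_of_var_ne_zero _ hv,
    ← withDensity_mul _ (measurable_gaussianPDF _ _) (by fun_prop)]
  congr 1
  ext x
  have hv' : (v : ℝ) ≠ 0 := by exact_mod_cast hv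
  rw [Pi.mul_apply, gaussianPDF, gaussianPDF, ← ENNReal.ofReal_mul (gaussianPDFReal_nonneg _ _ _),
    gaussianPDFReal, gaussianPDFReal, mul_assoc (√_)⁻¹, ← Real.exp_add]
  congr 3
  field_simp
  ring

/-- The Cameron–Martin formula for an isotropic Gaussian measure. -/
theorem pi_gaussianReal_map_add_const {ι : Type*} [Fintype ι] {v : ℝ≥0} (hv : v ≠ 0)
    (r : ι → ℝ) :
    (Measure.pi fun _ : ι => gaussianReal 0 v).map (fun x => x + r) =
      (Measure.pi fun _ : ι => gaussianReal 0 v).withDensity fun x =>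
        ENNReal.ofReal (Real.exp ((∑ i, r i * x i - (∑ i, r i ^ 2) / 2) / v)) := by
  have hmap : ∀ i, (gaussianReal 0 v).map (fun x => x + r i) =
      (gaussianReal 0 v).withDensity
        fun x => ENNReal.ofReal (Real.exp ((r i * x - r i ^ 2 / 2) / v)) := fun i => by
    rw [gaussianReal_map_add_const, zero_add, gaussianReal_eq_withDensity_gaussianReal_zero _ hv]
  have hprob : ∀ i, IsProbabilityMeasure ((gaussianReal 0 v).map (fun x => x + r i)) :=
    fun i => Measure.isProbabilityMeasure_map (by fun_prop)
  have hprob' : ∀ i, IsProbabilityMeasure ((gaussianReal 0 v).withDensity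
      fun x => ENNReal.ofReal (Real.exp ((r i * x - r i ^ 2 / 2) / v))) :=
    fun i => hmap i ▸ hprob i
  have hpi := Measure.pi_map_pi (μ := fun _ : ι => gaussianReal 0 v)
    (f := fun i x => x + r i) fun i => by fun_prop
  change (Measure.pi fun _ : ι => gaussianReal 0 v).map (fun x i => x i + r i) = _
  rw [hpi]
  simp_rw [hmap]
  rw [pi_withDensity_prod _ _ fun i => by fun_prop]
  congr 1
  ext x
  rw [← ENNReal.ofReal_prod_of_nonneg fun i _ => (Real.exp_pos _).le, ← Real.exp_sum,
    ← Finset.sum_div, Finset.sum_sub_distrib, Finset.sum_div]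

/-- A linear functional of an isotropic centred Gaussian vector is a centred Gaussian. -/
theorem pi_gaussianReal_map_sum_mul {ι : Type*} [Fintype ι] (v : ℝ≥0) (r : ι → ℝ) :
    (Measure.pi fun _ : ι => gaussianReal 0 v).map (fun x => ∑ i, r i * x i) =
      (gaussianReal 0 1).map (fun z => -(√v * √(∑ i, r i ^ 2)) * z) := by
  have hprob : ∀ i, IsProbabilityMeasure ((gaussianReal 0 v).map (fun x => r i * x)) :=
    fun i => Measure.isProbabilityMeasure_map (by fun_prop)
  have hpi := Measure.pi_map_pi (μ := fun _ : ι => gaussianReal 0 v)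
    (f := fun i x => r i * x) fun i => by fun_prop
  have hcomp : (Measure.pi fun _ : ι => gaussianReal 0 v).map (fun x => ∑ i, r i * x i) =
      (Measure.pi fun i => (gaussianReal 0 v).map (fun x => r i * x)).map (fun x => ∑ i, x i) := by
    rw [← hpi, Measure.map_map (by fun_prop) (by fun_prop)]
    rfl
  have : IsProbabilityMeasure
      ((gaussianReal 0 1).map (fun z => -(√v * √(∑ i, r i ^ 2)) * z)) :=
    Measure.isProbabilityMeasure_map (by fun_prop)
  have : IsProbabilityMeasure ((Measure.pi fun i =>
      (gaussianReal 0 v).map (fun x => r i * x)).map (fun x => ∑ i, x i)) :=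
    Measure.isProbabilityMeasure_map (by fun_prop)
  rw [hcomp]
  refine Measure.ext_of_charFun ?_
  rw [charFun_map_sum_pi_eq_prod]
  ext t
  have hs : (0 : ℝ) ≤ ∑ i, r i ^ 2 := Finset.sum_nonneg fun i _ => sq_nonneg _
  have hsq : (-(√v * √(∑ i, r i ^ 2))) ^ 2 = v * ∑ i, r i ^ 2 := by
    rw [neg_sq, mul_pow, Real.sq_sqrt v.coe_nonneg, Real.sq_sqrt hs]
  simp_rw [Finset.prod_apply, gaussianReal_map_const_mul, charFun_gaussianReal,
    ← Complex.exp_sum]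
  congr 1
  simp only [NNReal.coe_mul, NNReal.coe_mk, hsq]
  push_cast
  simp only [mul_zero, zero_mul, zero_sub, mul_one, Finset.sum_neg_distrib, Finset.mul_sum,
    Finset.sum_mul, Finset.sum_div]
  congr 1
  exact Finset.sum_congr rfl fun i _ => by ring

/-- Translating an isotropic Gaussian of standard deviation `σ` by a nonzero vector `r` increases
the mass of a set by at most `Φ(‖r‖ / (2σ))`. -/
theorem pi_gaussianReal_preimage_add_le {ι : Type*} [Fintype ι] {σ : ℝ≥0} (hσ : 0 < σ)
    {r : ι → ℝ} (hr : 0 < ∑ i, r i ^ 2) {A : Set (ι → ℝ)} (hA : MeasurableSet A) :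
    (Measure.pi fun _ : ι => gaussianReal 0 (σ ^ 2)) ((fun x => x + r) ⁻¹' A) ≤
      (Measure.pi fun _ : ι => gaussianReal 0 (σ ^ 2)) A +
        gaussianReal 0 1 (Set.Iic (√(∑ i, r i ^ 2) / (2 * σ))) := by
  set ν := Measure.pi fun _ : ι => gaussianReal 0 (σ ^ 2) with hν
  set S := ∑ i, r i ^ 2 with hS
  have hσ' : (0 : ℝ) < σ := hσ
  let H : Set (ι → ℝ) := {x | S / 2 ≤ ∑ i, r i * x i}
  have hH : MeasurableSet H := measurableSet_le (by fun_prop) (by fun_prop)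
  have hout : (ν.map fun x => x + r) (A \ H) ≤ ν A := by
    rw [pi_gaussianReal_map_add_const (pow_pos hσ 2).ne', withDensity_apply _ (hA.diff hH)]
    calc _ ≤ ∫⁻ _ in A \ H, 1 ∂ν := by
          refine setLIntegral_mono measurable_const fun x hx => ?_
          have hx' : ∑ i, r i * x i < S / 2 := not_le.mp hx.2
          rw [← ENNReal.ofReal_one]
          refine ENNReal.ofReal_le_ofReal (Real.exp_le_one_iff.2 ?_)
          exact div_nonpos_of_nonpos_of_nonneg (by linarith) (NNReal.coe_nonneg _)
      _ ≤ ν A := by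
          rw [setLIntegral_one]
          exact measure_mono Set.sdiff_subset
  have hin : (ν.map fun x => x + r) H = gaussianReal 0 1 (Set.Iic (√S / (2 * σ))) := by
    have hpre : (fun x => x + r) ⁻¹' H = (fun x => ∑ i, r i * x i) ⁻¹' Set.Ici (-(S / 2)) := by
      ext x
      have : ∑ i, r i * (x i + r i) = ∑ i, r i * x i + S := by
        rw [hS, ← Finset.sum_add_distrib]
        exact Finset.sum_congr rfl fun i _ => by ring
      simp only [H, Set.mem_preimage, Set.mem_ofPred_eq, Pi.add_apply, this, Set.mem_Ici]
      constructor <;> intro h <;> linarith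
    rw [Measure.map_apply (by fun_prop) hH, hpre, ← Measure.map_apply (by fun_prop)
      measurableSet_Ici, pi_gaussianReal_map_sum_mul, Measure.map_apply (by fun_prop)
      measurableSet_Ici]
    congr 1
    ext z
    have hs : 0 < √S := Real.sqrt_pos.2 hr
    have hss : √S * √S = S := Real.mul_self_sqrt hr.le
    rw [Set.mem_preimage, Set.mem_Ici, Set.mem_Iic, NNReal.coe_pow, Real.sqrt_sq hσ'.le,
      le_div_iff₀ (by positivity), ← hS]
    constructor
    · intro h
      refine le_of_mul_le_mul_left ?_ hs
      linarith
    · intro h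
      have := mul_le_mul_of_nonneg_left h hs.le
      linarith
  calc ν ((fun x => x + r) ⁻¹' A) = (ν.map fun x => x + r) A :=
        (Measure.map_apply (by fun_prop) hA).symm
    _ ≤ (ν.map fun x => x + r) (A \ H) + (ν.map fun x => x + r) H := by
        refine (measure_mono fun x hx => ?_).trans (measure_union_le _ _)
        exact (em (x ∈ H)).elim Or.inr fun h => Or.inl ⟨hx, h⟩
    _ ≤ _ := add_le_add hout hin.le

end ProbabilityTheory

/-- Example 1 (Robustness Conditions under Gaussian Distribution), guarantee direction:
if the watermark robustness `W` exceeds `Φ(R/σ) + τ`, then the stability exceeds `τ`. -/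
theorem certified_watermark_gaussian (d K : ℕ) (hK : 1 ≤ K)
    (σ : ℝ≥0) (hσ : 0 < σ) (R : ℝ) (hR : 0 ≤ R)
    (f : (Fin d → ℝ) → ℕ) (hf : Measurable f) (yhat : ℕ)
    (x r : Fin K → (Fin d → ℝ)) (hr : ∀ k, Real.sqrt (∑ i, (r k i) ^ 2) ≤ R)
    (W : ℝ) (hW : W ∈ Set.Icc (0 : ℝ) 1) (τ : ℝ)
    (hWR : ∀ k, (((Measure.pi fun i => ProbabilityTheory.gaussianReal 0 (σ ^ 2)))
        {ε : Fin d → ℝ | f (x k + r k + ε) = yhat}).toReal ≥ W)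
    (hcond : W > stdNormalCDF (R / (σ : ℝ)) + τ) :
    ∀ k, (((Measure.pi fun i => ProbabilityTheory.gaussianReal 0 (σ ^ 2)))
        {ε : Fin d → ℝ | f (x k + ε) = yhat}).toReal > τ := by
  intro k
  have hmeas : MeasurableSet {ε : Fin d → ℝ | f (x k + ε) = yhat} :=
    (hf.comp (measurable_const_add (x k))) (measurableSet_singleton yhat)
  have hΦ : 0 ≤ stdNormalCDF (R / (σ : ℝ)) := ENNReal.toReal_nonneg
  have hWk := hWR k
  rcases (Finset.sum_nonneg fun i _ => sq_nonneg (r k i)).eq_or_lt with h0 | hpos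
  · have hr0 : r k = 0 := by
      ext i
      have := (Finset.sum_eq_zero_iff_of_nonneg fun i _ => sq_nonneg (r k i)).1 h0.symm i
        (Finset.mem_univ i)
      exact pow_eq_zero_iff two_ne_zero |>.1 this
    rw [hr0, add_zero] at hWk
    linarith
  · have hset : {ε : Fin d → ℝ | f (x k + r k + ε) = yhat} =
        (fun ε => ε + r k) ⁻¹' {ε : Fin d → ℝ | f (x k + ε) = yhat} := by
      ext ε
      simp only [Set.mem_ofPred_eq, Set.mem_preimage, add_assoc, add_comm ε]
    rw [hset] at hWk
    have hle := ENNReal.toReal_mono (ENNReal.add_ne_top.2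
      ⟨measure_ne_top _ _, measure_ne_top _ _⟩)
      (ProbabilityTheory.pi_gaussianReal_preimage_add_le hσ hpos hmeas)
    rw [ENNReal.toReal_add (measure_ne_top _ _) (measure_ne_top _ _)] at hle
    have hσ' : (0 : ℝ) < σ := hσ
    have hcdf : (ProbabilityTheory.gaussianReal 0 1
        (Set.Iic (√(∑ i, r k i ^ 2) / (2 * σ)))).toReal ≤ stdNormalCDF (R / (σ : ℝ)) := by
      refine ENNReal.toReal_mono (measure_ne_top _ _) (measure_mono (Set.Iic_subset_Iic.2 ?_))
      exact div_le_div₀ hR (hr k) hσ' (by linarith)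
    linarith
end
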